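/- Fix n ∈ ℕ, an edge set E ⊆ {(i,j) : 1 ≤ i < j ≤ n}, a training set {(θ^(a), y^(a))}_{a=1,...,N} with θ^(a) ∈ ℝ^n and y^(a) ∈ ℝ, and parameters λ, ε ∈ ℝ. Suppose Γ ∈ ℝ^E is such that for every a ∈ {1,...,N} the minimizer z^{*,a} of z ↦ 𝖤(θ^(a),Γ,z) over {−1,1}^n is unique. Then the function Γ' ↦ 𝓛(Γ',λ,ε) is differentiable at Γ, and for every edge (i,j) ∈ E its partial derivative with respect to Γ_ij equals (2λ/N) · Σ_{a=1}^N [λ·𝖤₀(θ^(a),Γ) + ε − y^(a)] · z_i^{*,a} z_j^{*,a}. -/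

import Mathlib

open Finset MeasureTheory Filter Topology

namespace IsingML

/-- The set of spin configurations `{-1,1}^n`. -/
def spins (n : ℕ) : Set (Fin n → ℝ) := {z | ∀ i, z i = 1 ∨ z i = -1}

/-- The Ising energy `𝖤(θ,Γ,z) = ∑_i θ_i z_i + ∑_{(i,j)∈E} Γ_ij z_i z_j`. -/
def energy {n : ℕ} (E : Finset (Fin n × Fin n)) (θ : Fin n → ℝ) (Γ : {e // e ∈ E} → ℝ)
    (z : Fin n → ℝ) : ℝ :=
  ∑ i, θ i * z i + ∑ e : {e // e ∈ E}, Γ e * z e.1.1 * z e.1.2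

/-- The ground-state energy `𝖤₀(θ,Γ) = min_{z ∈ {-1,1}^n} 𝖤(θ,Γ,z)`. -/
noncomputable def groundEnergy {n : ℕ} (E : Finset (Fin n × Fin n)) (θ : Fin n → ℝ)
    (Γ : {e // e ∈ E} → ℝ) : ℝ :=
  sInf (energy E θ Γ '' spins n)

/-- `z` is a minimizer (ground state) of the Ising energy. -/
def IsMinimizer {n : ℕ} (E : Finset (Fin n × Fin n)) (θ : Fin n → ℝ) (Γ : {e // e ∈ E} → ℝ)
    (z : Fin n → ℝ) : Prop :=
  z ∈ spins n ∧ ∀ z' ∈ spins n, energy E θ Γ z ≤ energy E θ Γ z'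

/-- The MSE loss `𝓛(Γ,λ,ε) = (1/N) ∑_a (λ·𝖤₀(θ⁽ᵃ⁾,Γ) + ε - y⁽ᵃ⁾)²` over a training set. -/
noncomputable def loss {n : ℕ} (E : Finset (Fin n × Fin n)) {N : ℕ}
    (θs : Fin N → Fin n → ℝ) (ys : Fin N → ℝ)
    (Γ : {e // e ∈ E} → ℝ) (lam eps : ℝ) : ℝ :=
  (1 / (N : ℝ)) * ∑ a, (lam * groundEnergy E (θs a) Γ + eps - ys a) ^ 2

theorem finite_spins (n : ℕ) : (spins n).Finite := by
  have h : (Set.univ.pi fun _ : Fin n => ({1, -1} : Set ℝ)).Finite :=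
    Set.Finite.pi fun _ => Set.toFinite _
  exact h.subset fun z hz i _ => hz i

theorem IsMinimizer.groundEnergy_eq {n : ℕ} {E : Finset (Fin n × Fin n)} {θ : Fin n → ℝ}
    {Γ : {e // e ∈ E} → ℝ} {z : Fin n → ℝ} (hz : IsMinimizer E θ Γ z) :
    groundEnergy E θ Γ = energy E θ Γ z :=
  IsLeast.csInf_eq ⟨Set.mem_image_of_mem _ hz.1, Set.forall_mem_image.2 hz.2⟩

theorem hasFDerivAt_energy {n : ℕ} (E : Finset (Fin n × Fin n)) (θ : Fin n → ℝ)
    (Γ : {e // e ∈ E} → ℝ) (z : Fin n → ℝ) :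
    HasFDerivAt (fun Γ' => energy E θ Γ' z)
      (∑ e : {e // e ∈ E}, (z e.1.1 * z e.1.2) •
        (ContinuousLinearMap.proj e : ({e // e ∈ E} → ℝ) →L[ℝ] ℝ)) Γ := by
  have h (e : {e // e ∈ E}) :
      HasFDerivAt (fun Γ' : {e // e ∈ E} → ℝ => Γ' e * z e.1.1 * z e.1.2)
        ((z e.1.1 * z e.1.2) •
          (ContinuousLinearMap.proj e : ({e // e ∈ E} → ℝ) →L[ℝ] ℝ)) Γ := by
    simpa only [mul_assoc] using (hasFDerivAt_apply (𝕜 := ℝ) e Γ).mul_const (z e.1.1 * z e.1.2)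
  exact (HasFDerivAt.fun_sum fun e _ => h e).const_add _

/-- A unique minimizer remains a minimizer under small perturbations of the couplings. -/
theorem IsMinimizer.eventually {n : ℕ} {E : Finset (Fin n × Fin n)} {θ : Fin n → ℝ}
    {Γ : {e // e ∈ E} → ℝ} {z : Fin n → ℝ} (hz : IsMinimizer E θ Γ z)
    (huniq : ∀ z', IsMinimizer E θ Γ z' → z' = z) :
    ∀ᶠ Γ' in 𝓝 Γ, IsMinimizer E θ Γ' z := by
  have h : ∀ᶠ Γ' in 𝓝 Γ, ∀ z' ∈ spins n, energy E θ Γ' z ≤ energy E θ Γ' z' := by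
    refine (Filter.eventually_all_finite (finite_spins n)).2 fun z' hz' => ?_
    rcases eq_or_ne z' z with rfl | hne
    · exact Eventually.of_forall fun _ => le_rfl
    have hlt : energy E θ Γ z < energy E θ Γ z' := by
      by_contra! hle
      exact hne (huniq z' ⟨hz', fun w hw => hle.trans (hz.2 w hw)⟩)
    exact ((hasFDerivAt_energy E θ Γ z).continuousAt.eventually_lt
      (hasFDerivAt_energy E θ Γ z').continuousAt hlt).mono fun _ => le_of_lt
  exact h.mono fun _ hΓ' => ⟨hz.1, hΓ'⟩

theorem IsMinimizer.hasFDerivAt_groundEnergy {n : ℕ} {E : Finset (Fin n × Fin n)}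
    {θ : Fin n → ℝ} {Γ : {e // e ∈ E} → ℝ} {z : Fin n → ℝ} (hz : IsMinimizer E θ Γ z)
    (huniq : ∀ z', IsMinimizer E θ Γ z' → z' = z) :
    HasFDerivAt (groundEnergy E θ)
      (∑ e : {e // e ∈ E}, (z e.1.1 * z e.1.2) •
        (ContinuousLinearMap.proj e : ({e // e ∈ E} → ℝ) →L[ℝ] ℝ)) Γ :=
  (hasFDerivAt_energy E θ Γ z).congr_of_eventuallyEq
    ((hz.eventually huniq).mono fun _ h => h.groundEnergy_eq)

/-- if for every training sample the minimizer of the Ising energy at `Γ` is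
unique, then the loss is differentiable in `Γ` and its partial derivative with respect to the
coupling `Γ_ij` of each edge `(i,j) ∈ E` equals
`(2λ/N) ∑_a (λ·𝖤₀(θ⁽ᵃ⁾,Γ) + ε - y⁽ᵃ⁾) z*ᵢ z*ⱼ`. -/
theorem stmt0 {n N : ℕ} (hN : 0 < N) (E : Finset (Fin n × Fin n))
    (hE : ∀ e ∈ E, e.1 < e.2)
    (θs : Fin N → Fin n → ℝ) (ys : Fin N → ℝ) (lam eps : ℝ)
    (Γ : {e // e ∈ E} → ℝ)
    (huniq : ∀ a, ∃! z, IsMinimizer E (θs a) Γ z)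
    (zstar : Fin N → Fin n → ℝ)
    (hzstar : ∀ a, IsMinimizer E (θs a) Γ (zstar a)) :
    DifferentiableAt ℝ (fun Γ' => loss E θs ys Γ' lam eps) Γ ∧
    ∀ e : {e // e ∈ E},
      fderiv ℝ (fun Γ' => loss E θs ys Γ' lam eps) Γ (Pi.single e 1) =
        (2 * lam / (N : ℝ)) * ∑ a, (lam * groundEnergy E (θs a) Γ + eps - ys a) *
          (zstar a e.1.1 * zstar a e.1.2) := by
  have hloss := (HasFDerivAt.fun_sum (u := Finset.univ) fun a _ =>
    (((((hzstar a).hasFDerivAt_groundEnergy fun z hz =>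
      (huniq a).unique hz (hzstar a)).const_mul lam).add_const eps).sub_const (ys a)).pow 2).const_mul
        (1 / (N : ℝ))
  refine ⟨hloss.differentiableAt, fun e => ?_⟩
  refine (congrArg (fun L => L (Pi.single e 1)) hloss.fderiv).trans ?_
  simp [Finset.mul_sum, Pi.single_apply]
  refine Finset.sum_congr rfl fun a _ => ?_
  ring

end IsingML
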